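/- Let ε : [0,∞) → ℝ be a positive continuous function and let (β_j)_{j≥0} be a sequence of real numbers with 0 < β₀ < ε(0) and such that either β_j = 0 for all j > 0, or the least j > 0 with β_j ≠ 0 satisfies β_j < 0. Then there is a positive C^∞ function u on [0,∞) such that: (1) Du(x) < 0 for x > 0; (2) D^j u(0) = β_j for all j ≥ 0; (3) ∫_x^∞ u(t) dt < u(x) < ε(x) for all x ≥ 0. -/

import Mathlib

open Set MeasureTheory
open scoped ContDiff

/-- There is a compactly supported smooth function whose only nonzero derivative at `0` is the
`n`-th, with prescribed value, and whose derivatives of order less than `n` are uniformly small. -/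
theorem exists_contDiff_iteratedDeriv_eq_single (n : ℕ) (c : ℝ) {η : ℝ} (hη : 0 < η) :
    ∃ g : ℝ → ℝ, ContDiff ℝ ∞ g ∧ HasCompactSupport g ∧
      (∀ k, iteratedDeriv k g 0 = if k = n then c else 0) ∧
      ∀ k < n, ∀ x, ‖iteratedDeriv k g x‖ ≤ η := by
  let χ : ContDiffBump (0 : ℝ) := default
  have hχs : HasCompactSupport χ := χ.hasCompactSupport
  let ψ : ℝ → ℝ := fun x ↦ x ^ n * χ x
  have hψ : ContDiff ℝ ∞ ψ := (contDiff_id.pow n).mul χ.contDiff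
  have hψs : HasCompactSupport ψ := hχs.mul_left
  have hψ0 (k : ℕ) : iteratedDeriv k ψ 0 = if k = n then (n.factorial : ℝ) else 0 := by
    have : ψ =ᶠ[nhds 0] fun x ↦ x ^ n := by
      filter_upwards [χ.eventuallyEq_one] with x hx
      simp [ψ, hx]
    rw [this.iteratedDeriv_eq, iteratedDeriv_fun_pow_zero]
    split_ifs <;> simp
  have hbdd (k : ℕ) : ∃ C, ∀ x, ‖iteratedFDeriv ℝ k ψ x‖ ≤ C :=
    (hψs.iteratedFDeriv k).exists_bound_of_continuous
      (hψ.continuous_iteratedFDeriv (mod_cast le_top))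
  choose C hC using hbdd
  have hC0 (k : ℕ) : 0 ≤ C k := (norm_nonneg _).trans (hC k 0)
  set a : ℝ := c / n.factorial with ha
  set M : ℝ := ∑ k ∈ Finset.range n, C k with hM
  have hM0 : 0 ≤ M := Finset.sum_nonneg fun k _ ↦ hC0 k
  set l : ℝ := 1 + |a| * M / η with hl
  have hl1 : 1 ≤ l := le_add_of_nonneg_right (by positivity)
  have hl0 : 0 < l := by linarith
  have hder (k : ℕ) (x : ℝ) : iteratedDeriv k (fun x ↦ a * (l⁻¹) ^ n * ψ (l * x)) x =
      a * (l⁻¹) ^ n * (l ^ k * iteratedDeriv k ψ (l * x)) := by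
    rw [iteratedDeriv_const_mul_field,
      iteratedDeriv_comp_const_mul (hψ.of_le (mod_cast le_top))]
  refine ⟨fun x ↦ a * (l⁻¹) ^ n * ψ (l * x), ?_, ?_, ?_, ?_⟩
  · exact contDiff_const.mul (hψ.comp (contDiff_const.mul contDiff_id))
  · exact (hψs.comp_homeomorph (Homeomorph.mulLeft₀ l hl0.ne')).mul_left
  · intro k
    rw [hder, mul_zero, hψ0]
    split_ifs with h
    · subst h
      have : (k.factorial : ℝ) ≠ 0 := by positivity
      rw [ha, mul_assoc, ← mul_assoc (l⁻¹ ^ k), ← mul_pow, inv_mul_cancel₀ hl0.ne', one_pow,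
        one_mul, div_mul_cancel₀ _ this]
    · simp
  · intro k hk x
    rw [hder]
    have h1 : ‖iteratedDeriv k ψ (l * x)‖ ≤ M := by
      rw [← norm_iteratedFDeriv_eq_norm_iteratedDeriv]
      exact (hC k _).trans (Finset.single_le_sum (fun i _ ↦ hC0 i) (Finset.mem_range.2 hk))
    have h2 : (l⁻¹) ^ n * l ^ k ≤ l⁻¹ := by
      obtain ⟨m, rfl⟩ : ∃ m, n = k + 1 + m := ⟨n - k - 1, by omega⟩
      have : (l⁻¹) ^ (k + 1 + m) * l ^ k = l⁻¹ * (l⁻¹) ^ m := by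
        have h4 : (l⁻¹) ^ k * l ^ k = 1 := by rw [← mul_pow, inv_mul_cancel₀ hl0.ne', one_pow]
        rw [pow_add, pow_succ]
        linear_combination l⁻¹ * (l⁻¹) ^ m * h4
      rw [this]
      exact mul_le_of_le_one_right (by positivity)
        (pow_le_one₀ (by positivity) (inv_le_one_of_one_le₀ hl1))
    have h3 : |a| * M ≤ η * l := by
      rw [hl, mul_add, mul_div_cancel₀ _ hη.ne']; linarith
    calc ‖a * (l⁻¹) ^ n * (l ^ k * iteratedDeriv k ψ (l * x))‖
        = |a| * ((l⁻¹) ^ n * l ^ k) * ‖iteratedDeriv k ψ (l * x)‖ := by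
          simp only [norm_mul, norm_pow, norm_inv, Real.norm_eq_abs, abs_of_pos hl0]; ring
      _ ≤ |a| * l⁻¹ * M := by gcongr
      _ = |a| * M / l := by ring
      _ ≤ η := (div_le_iff₀ hl0).2 h3

/-- **Borel's lemma**: every real sequence is the sequence of derivatives at `0` of a
smooth function. -/
theorem exists_contDiff_iteratedDeriv_zero_eq (b : ℕ → ℝ) :
    ∃ f : ℝ → ℝ, ContDiff ℝ ∞ f ∧ ∀ k, iteratedDeriv k f 0 = b k := by
  choose g hg hgs hg0 hgb using fun n ↦
    exists_contDiff_iteratedDeriv_eq_single n (b n) (η := (1 / 2 : ℝ) ^ n) (by positivity)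
  have hbdd (k n : ℕ) : ∃ C, ∀ x, ‖iteratedFDeriv ℝ k (g n) x‖ ≤ C :=
    ((hgs n).iteratedFDeriv k).exists_bound_of_continuous
      ((hg n).continuous_iteratedFDeriv (mod_cast le_top))
  choose C hC using hbdd
  let v : ℕ → ℕ → ℝ := fun k n ↦ if k < n then (1 / 2 : ℝ) ^ n else C k n
  have hv (k : ℕ) : Summable (v k) := by
    refine summable_geometric_two.congr_cofinite ?_
    rw [Nat.cofinite_eq_atTop]
    filter_upwards [Filter.eventually_gt_atTop k] with n hn
    simp [v, hn]
  have hgv (k n : ℕ) (x : ℝ) : ‖iteratedFDeriv ℝ k (g n) x‖ ≤ v k n := by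
    simp only [v]
    split_ifs with h
    · rw [norm_iteratedFDeriv_eq_norm_iteratedDeriv]
      exact hgb n k h x
    · exact hC k n x
  refine ⟨fun x ↦ ∑' n, g n x,
    contDiff_tsum (N := ⊤) hg (fun k _ ↦ hv k) fun k n x _ ↦ hgv k n x, fun k ↦ ?_⟩
  have hsum : Summable fun n ↦ iteratedFDeriv ℝ k (g n) 0 :=
    .of_norm_bounded (hv k) fun n ↦ hgv k n 0
  rw [iteratedDeriv_eq_iteratedFDeriv, iteratedFDeriv_tsum_apply (N := ⊤) hg (fun k _ ↦ hv k)
    (fun k n x _ ↦ hgv k n x) le_top, ContinuousMultilinearMap.tsum_eval hsum]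
  simp_rw [← iteratedDeriv_eq_iteratedFDeriv, hg0]
  rw [tsum_eq_single k fun n hn ↦ if_neg hn.symm, if_pos rfl]

/-- If the first nonvanishing derivative of `g` at `0` is negative, then `g` is negative just to the
right of `0`. -/
theorem eventually_neg_of_iteratedDeriv_neg (n : ℕ) {g : ℝ → ℝ} (hg : ContDiff ℝ ∞ g)
    (h0 : ∀ i < n, iteratedDeriv i g 0 = 0) (hn : iteratedDeriv n g 0 < 0) :
    ∀ᶠ x in nhdsWithin 0 (Ioi 0), g x < 0 := by
  induction n generalizing g with
  | zero =>
    rw [iteratedDeriv_zero] at hn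
    exact (hg.continuous.continuousAt.eventually_lt_const hn).filter_mono nhdsWithin_le_nhds
  | succ n ih =>
    have h := ih (contDiff_infty_iff_deriv.1 hg).2
      (fun i hi ↦ by rw [← iteratedDeriv_succ']; exact h0 _ (by omega))
      (by rwa [← iteratedDeriv_succ'])
    obtain ⟨δ, hδ, hδ'⟩ := mem_nhdsGT_iff_exists_Ioo_subset.1 h
    have hanti : StrictAntiOn g (Ico 0 δ) := by
      refine strictAntiOn_of_deriv_neg (convex_Ico 0 δ) hg.continuous.continuousOn fun x hx ↦ ?_
      rw [interior_Ico] at hx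
      exact hδ' hx
    filter_upwards [Ioo_mem_nhdsGT hδ] with x hx
    have hg0 : g 0 = 0 := by simpa using h0 0 (by omega)
    rw [← hg0]
    exact hanti ⟨le_rfl, hδ⟩ ⟨hx.1.le, hx.2⟩ hx.1

/-- A positive continuous function on `[0, ∞)` dominates a positive smooth function whose
logarithmic derivative is at most `-2`. -/
theorem exists_contDiff_lt_and_deriv_le {ε : ℝ → ℝ} (hεc : ContinuousOn ε (Ici 0))
    (hεpos : ∀ x ∈ Ici (0 : ℝ), 0 < ε x) :
    ∃ v : ℝ → ℝ, ContDiff ℝ ∞ v ∧ (∀ x, 0 < v x) ∧ (∀ x ∈ Ici (0 : ℝ), v x < ε x) ∧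
      ∀ x, deriv v x ≤ -2 * v x := by
  let φ : ℝ → ℝ := fun x ↦ (ε x)⁻¹
  have hφ : ContinuousOn φ (Ici 0) := hεc.inv₀ fun x hx ↦ (hεpos x hx).ne'
  obtain ⟨h, hh⟩ := exists_contMDiffMap_forall_mem_convex_of_local_const (n := ⊤)
    (modelWithCornersSelf ℝ ℝ) (M := ℝ) (F := ℝ)
    (t := fun y ↦ {c | 2 ≤ c ∧ ∀ s ∈ Icc 0 y, φ s ≤ c})
    (fun y ↦ by
      intro p hp q hq a b ha hb hab
      refine ⟨?_, fun s hs ↦ ?_⟩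
      · exact (convex_Ici (2 : ℝ)) hp.1 hq.1 ha hb hab
      · exact (convex_Ici (φ s)) (hp.2 s hs) (hq.2 s hs) ha hb hab)
    (fun x ↦ by
      obtain ⟨B, hB⟩ := (isCompact_Icc (a := (0 : ℝ)) (b := x + 1)).bddAbove_image
        (hφ.mono fun s hs ↦ hs.1)
      refine ⟨max 2 B, ?_⟩
      filter_upwards [Iio_mem_nhds (show x < x + 1 by linarith)] with y hy
      refine ⟨le_max_left _ _, fun s hs ↦ le_max_of_le_right (hB ⟨s, ⟨hs.1, ?_⟩, rfl⟩)⟩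
      exact hs.2.trans (le_of_lt hy))
  have hsm : ContDiff ℝ ∞ h := h.contMDiff.contDiff
  have hc : Continuous h := hsm.continuous
  let g : ℝ → ℝ := fun x ↦ ∫ t in (0 : ℝ)..(x + 1), h t
  have hgd (x : ℝ) : HasDerivAt g (h (x + 1)) x :=
    (hc.integral_hasStrictDerivAt 0 (x + 1)).hasDerivAt.comp_add_const x 1
  have hgs : ContDiff ℝ ∞ g := by
    rw [contDiff_infty_iff_deriv]
    refine ⟨fun x ↦ (hgd x).differentiableAt, ?_⟩
    rw [show deriv g = fun x ↦ h (x + 1) from funext fun x ↦ (hgd x).deriv]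
    exact hsm.comp (contDiff_id.add contDiff_const)
  have hgφ : ∀ x ∈ Ici (0 : ℝ), φ x ≤ g x := by
    intro x hx
    have hi (a b : ℝ) : IntervalIntegrable h volume a b := hc.intervalIntegrable a b
    have e : g x = (∫ t in (0 : ℝ)..x, h t) + ∫ t in x..(x + 1), h t :=
      (intervalIntegral.integral_add_adjacent_intervals (hi _ _) (hi _ _)).symm
    have p : 0 ≤ ∫ t in (0 : ℝ)..x, h t :=
      intervalIntegral.integral_nonneg hx fun t _ ↦ by linarith [(hh t).1]
    have q : ∫ t in x..(x + 1), φ x ≤ ∫ t in x..(x + 1), h t :=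
      intervalIntegral.integral_mono_on (by linarith) (by simp) (hi _ _)
        fun t ht ↦ (hh t).2 x ⟨hx, ht.1⟩
    simp at q
    linarith
  have hvd (x : ℝ) : HasDerivAt (fun x ↦ Real.exp (-g x)) (Real.exp (-g x) * -h (x + 1)) x :=
    (hgd x).neg.exp
  refine ⟨fun x ↦ Real.exp (-g x), hgs.neg.exp, fun x ↦ Real.exp_pos _, fun x hx ↦ ?_,
    fun x ↦ ?_⟩
  · have h1 : 0 < φ x := inv_pos.2 (hεpos x hx)
    have h2 : φ x < Real.exp (g x) := by linarith [hgφ x hx, Real.add_one_le_exp (g x)]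
    change Real.exp (-g x) < ε x
    rw [Real.exp_neg]
    exact inv_lt_of_inv_lt₀ (hεpos x hx) h2
  · rw [(hvd x).deriv]
    nlinarith [Real.exp_pos (-g x), (hh (x + 1)).1]


/-- A positive function with logarithmic derivative at most `-2` is integrable at infinity, with
tail integrals at most half its value. -/
theorem integrableOn_and_integral_le_of_deriv_le {v : ℝ → ℝ} (hv : Differentiable ℝ v)
    (hv0 : ∀ x, 0 < v x) (hvd : ∀ x, deriv v x ≤ -2 * v x) (a : ℝ) :
    IntegrableOn v (Ioi a) ∧ ∫ t in Ioi a, v t ≤ v a / 2 := by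
  have hd0 (x : ℝ) : deriv v x ≤ 0 := by linarith [hv0 x, hvd x]
  have hbdd : BddBelow (range v) := ⟨0, by rintro _ ⟨x, rfl⟩; exact (hv0 x).le⟩
  have hlim := tendsto_atTop_ciInf (antitone_of_deriv_nonpos hv hd0) hbdd
  have hl : 0 ≤ ⨅ x, v x := le_ciInf fun x ↦ (hv0 x).le
  have hderiv : ∀ x ∈ Ici a, HasDerivAt v (deriv v x) x := fun x _ ↦ (hv x).hasDerivAt
  have hint := integrableOn_Ioi_deriv_of_nonpos' hderiv (fun x _ ↦ hd0 x) hlim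
  have heq := integral_Ioi_of_hasDerivAt_of_nonpos' hderiv (fun x _ ↦ hd0 x) hlim
  have hint' : IntegrableOn (fun x ↦ (-1 / 2) * deriv v x) (Ioi a) := hint.const_mul (-1 / 2)
  have hvint : IntegrableOn v (Ioi a) := by
    refine hint'.mono' hv.continuous.aestronglyMeasurable (ae_of_all _ fun x ↦ ?_)
    rw [Real.norm_of_nonneg (hv0 x).le]
    linarith [hvd x]
  refine ⟨hvint, ?_⟩
  have := integral_mono hvint hint' fun x ↦ (by linarith [hvd x] : v x ≤ (-1 / 2) * deriv v x)
  rw [integral_const_mul, heq] at this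
  linarith

theorem iteratedDeriv_expNegInvGlue_zero (k : ℕ) : iteratedDeriv k expNegInvGlue 0 = 0 := by
  have hc : Continuous (iteratedDeriv k expNegInvGlue) :=
    (expNegInvGlue.contDiff (n := k)).continuous_iteratedDeriv k le_rfl
  have hz : EqOn (iteratedDeriv k expNegInvGlue) (fun _ ↦ 0) (Iio 0) := by
    have h : EqOn expNegInvGlue (fun _ ↦ 0) (Iio 0) := fun x hx ↦
      expNegInvGlue.zero_of_nonpos (le_of_lt hx)
    intro x hx
    rw [h.iteratedDeriv_of_isOpen isOpen_Iio k hx, iteratedDeriv_fun_const_zero]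
  exact hz.closure hc continuous_const (by simp)

/-- A sequence whose first nonzero term after the zeroth (if any) is negative is the sequence of
derivatives at `0` of a smooth function that decreases just to the right of `0`. -/
theorem exists_contDiff_iteratedDeriv_zero_eq_and_deriv_neg {β : ℕ → ℝ}
    (hβ : (∀ j, 0 < j → β j = 0) ∨
      ∃ j, 0 < j ∧ β j < 0 ∧ ∀ i, 0 < i → i < j → β i = 0) :
    ∃ f : ℝ → ℝ, ContDiff ℝ ∞ f ∧ (∀ k, iteratedDeriv k f 0 = β k) ∧
      ∀ᶠ x in nhdsWithin 0 (Ioi 0), deriv f x < 0 := by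
  rcases hβ with hβ | ⟨j, hj, hβj, hβ⟩
  · have hd (x : ℝ) : HasDerivAt (fun x ↦ β 0 - ∫ t in (0 : ℝ)..x, expNegInvGlue t)
        (-expNegInvGlue x) x :=
      ((expNegInvGlue.contDiff (n := 0)).continuous.integral_hasStrictDerivAt
        0 x).hasDerivAt.const_sub (β 0)
    have hde := funext fun x ↦ (hd x).deriv
    refine ⟨fun x ↦ β 0 - ∫ t in (0 : ℝ)..x, expNegInvGlue t, ?_, fun k ↦ ?_, ?_⟩
    · rw [contDiff_infty_iff_deriv, hde]
      exact ⟨fun x ↦ (hd x).differentiableAt, expNegInvGlue.contDiff.neg⟩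
    · cases k with
      | zero => simp
      | succ k =>
        rw [iteratedDeriv_succ', hde, iteratedDeriv_fun_neg, iteratedDeriv_expNegInvGlue_zero,
          neg_zero, hβ _ k.succ_pos]
    · filter_upwards [self_mem_nhdsWithin] with x hx
      rw [(hd x).deriv]
      exact neg_neg_of_pos (expNegInvGlue.pos_of_pos hx)
  · obtain ⟨f, hf, hfβ⟩ := exists_contDiff_iteratedDeriv_zero_eq β
    obtain ⟨n, rfl⟩ : ∃ n, j = n + 1 := ⟨j - 1, by omega⟩
    refine ⟨f, hf, hfβ, eventually_neg_of_iteratedDeriv_neg n (contDiff_infty_iff_deriv.1 hf).2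
      (fun i hi ↦ ?_) ?_⟩
    · rw [← iteratedDeriv_succ', hfβ, hβ _ i.succ_pos (by omega)]
    · rwa [← iteratedDeriv_succ', hfβ]

/-- A smooth antitone cutoff, equal to `1` near `0` and vanishing exactly on `[δ, ∞)`. -/
theorem exists_antitone_contDiff_eq_one_eq_zero {δ : ℝ} (hδ : 0 < δ) :
    ∃ χ : ℝ → ℝ, ContDiff ℝ ∞ χ ∧ Antitone χ ∧ (∀ x, χ x ∈ Icc 0 1) ∧ (∀ᶠ x in nhds 0, χ x = 1) ∧
      (∀ x < δ, 0 < χ x) ∧ ∀ x, δ ≤ x → χ x = 0 := by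
  refine ⟨fun x ↦ Real.smoothTransition (2 * (1 - x / δ)), ?_, fun x y h ↦ ?_, fun x ↦
    ⟨Real.smoothTransition.nonneg _, Real.smoothTransition.le_one _⟩, ?_, fun x hx ↦ ?_,
    fun x hx ↦ ?_⟩
  · exact Real.smoothTransition.contDiff.comp (by fun_prop)
  · exact Real.smoothTransition.monotone (by gcongr)
  · filter_upwards [Iio_mem_nhds (half_pos hδ)] with x hx
    have : x / δ ≤ 1 / 2 := by rw [div_le_iff₀ hδ]; linarith [mem_Iio.1 hx]
    exact Real.smoothTransition.one_of_one_le (by linarith)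
  · have : x / δ < 1 := (div_lt_one hδ).2 hx
    exact Real.smoothTransition.pos_of_pos (by linarith)
  · have : 1 ≤ x / δ := (one_le_div hδ).2 hx
    exact Real.smoothTransition.zero_of_nonpos (by linarith)

/-- Existence of a positive strictly decreasing `C^∞` function `u` on `[0,∞)`
with prescribed derivatives at `0` satisfying `∫_x^∞ u < u(x) < ε(x)`. -/
theorem exists_u_drops_quickly_to_zero
    (ε : ℝ → ℝ) (hεc : ContinuousOn ε (Ici 0)) (hεpos : ∀ x ∈ Ici (0 : ℝ), 0 < ε x)
    (β : ℕ → ℝ) (hβ0 : 0 < β 0) (hβε : β 0 < ε 0)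
    (hβ : (∀ j, 0 < j → β j = 0) ∨
      ∃ j, 0 < j ∧ β j < 0 ∧ ∀ i, 0 < i → i < j → β i = 0) :
    ∃ u : ℝ → ℝ, ContDiffOn ℝ (⊤ : ℕ∞) u (Ici 0) ∧ (∀ x ∈ Ici (0 : ℝ), 0 < u x) ∧
      IntegrableOn u (Ici 0) ∧
      (∀ x > (0 : ℝ), derivWithin u (Ici 0) x < 0) ∧
      (∀ j, iteratedDerivWithin j u (Ici 0) 0 = β j) ∧
      (∀ x ∈ Ici (0 : ℝ), (∫ t in Ioi x, u t) < u x ∧ u x < ε x) := by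
  obtain ⟨f, hf, hfβ, hfd⟩ := exists_contDiff_iteratedDeriv_zero_eq_and_deriv_neg hβ
  have hf0 : f 0 = β 0 := by simpa using hfβ 0
  obtain ⟨δ, hδ, hS⟩ : ∃ δ > 0, ∀ x ∈ Ioc 0 δ, deriv f x < 0 ∧ 0 < f x ∧ f x < ε x ∧ x < 1 / 2 := by
    refine (mem_nhdsGT_iff_exists_Ioc_subset (a := (0 : ℝ))).1 ?_
    have hfc : ContinuousWithinAt f (Ioi 0) 0 := hf.continuous.continuousWithinAt
    have hεc0 : ContinuousWithinAt ε (Ioi 0) 0 := (hεc 0 self_mem_Ici).mono Ioi_subset_Ici_self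
    filter_upwards [hfd, hfc.eventually_const_lt (u := 0) (by rwa [hf0]),
      hfc.eventually_lt hεc0 (by rwa [hf0]), Ioo_mem_nhdsGT (show (0 : ℝ) < 1 / 2 by norm_num)]
      with x h1 h2 h3 h4 using ⟨h1, h2, h3, h4.2⟩
  have hδS := hS δ ⟨hδ, le_rfl⟩
  have hfanti : AntitoneOn f (Icc 0 δ) := by
    refine (strictAntiOn_of_deriv_neg (convex_Icc 0 δ) hf.continuous.continuousOn
      fun x hx ↦ ?_).antitoneOn
    rw [interior_Icc] at hx
    exact (hS x ⟨hx.1, hx.2.le⟩).1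
  have hfpos : ∀ x ∈ Icc 0 δ, 0 < f x := fun x hx ↦
    hδS.2.1.trans_le (hfanti hx ⟨hδ.le, le_rfl⟩ hx.2)
  have hfε : ∀ x ∈ Icc 0 δ, f x < ε x := fun x hx ↦ by
    rcases hx.1.eq_or_lt with rfl | h
    · rwa [hf0]
    · exact (hS x ⟨h, hx.2⟩).2.2.1
  obtain ⟨v, hv, hv0, hvε, hvd⟩ := exists_contDiff_lt_and_deriv_le (ε := fun x ↦ min (ε x) (f δ))
    (hεc.inf continuousOn_const) fun x hx ↦ lt_min (hεpos x hx) hδS.2.1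
  have hvf : ∀ x ∈ Icc 0 δ, v x < f x := fun x hx ↦
    (lt_min_iff.1 (hvε x hx.1)).2.trans_le (hfanti hx ⟨hδ.le, le_rfl⟩ hx.2)
  have hvi := integrableOn_and_integral_le_of_deriv_le (hv.differentiable (by simp)) hv0 hvd
  obtain ⟨χ, hχ, hχanti, hχI, hχ1, hχpos, hχ0⟩ := exists_antitone_contDiff_eq_one_eq_zero hδ
  let u : ℝ → ℝ := fun x ↦ χ x * f x + (1 - χ x) * v x
  have hu : ContDiff ℝ ∞ u := (hχ.mul hf).add ((contDiff_const.sub hχ).mul hv)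
  have huv {x : ℝ} (hx : δ ≤ x) : u x = v x := by simp [u, hχ0 x hx]
  have hu0 : ∀ x ∈ Ici (0 : ℝ), 0 < u x := fun x hx ↦ by
    rcases le_total δ x with h | h
    · rw [huv h]; exact hv0 x
    · have := hvf x ⟨hx, h⟩
      nlinarith [mul_nonneg (hχI x).1 (sub_nonneg.2 this.le), hv0 x]
  have huε : ∀ x ∈ Ici (0 : ℝ), u x < ε x := fun x hx ↦ by
    rcases le_total δ x with h | h
    · rw [huv h]; exact (lt_min_iff.1 (hvε x hx)).1
    · have := hfε x ⟨hx, h⟩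
      nlinarith [mul_nonneg (sub_nonneg.2 (hχI x).2) (sub_nonneg.2 (hvf x ⟨hx, h⟩).le)]
  have hud : ∀ x > (0 : ℝ), deriv u x < 0 := fun x hx ↦ by
    have hχx : HasDerivAt χ (deriv χ x) x := (hχ.differentiable (by simp) x).hasDerivAt
    have hfx : HasDerivAt f (deriv f x) x := (hf.differentiable (by simp) x).hasDerivAt
    have hvx : HasDerivAt v (deriv v x) x := (hv.differentiable (by simp) x).hasDerivAt
    have hux : HasDerivAt u _ x := (hχx.mul hfx).add ((hχx.const_sub 1).mul hvx)
    rw [hux.deriv]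
    have hvneg : deriv v x < 0 := by linarith [hv0 x, hvd x]
    rcases le_or_gt δ x with h | h
    · have hmin : deriv χ x = 0 := IsLocalMin.deriv_eq_zero <| Filter.Eventually.of_forall
        fun y ↦ by rw [hχ0 x h]; exact (hχI y).1
      simpa [hmin, hχ0 x h] using hvneg
    · have h1 : deriv χ x * (f x - v x) ≤ 0 :=
        mul_nonpos_of_nonpos_of_nonneg hχanti.deriv_nonpos (sub_nonneg.2 (hvf x ⟨hx.le, h.le⟩).le)
      have h2 : χ x * deriv f x < 0 := mul_neg_of_pos_of_neg (hχpos x h) (hS x ⟨hx, h.le⟩).1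
      have h3 : (1 - χ x) * deriv v x ≤ 0 :=
        mul_nonpos_of_nonneg_of_nonpos (sub_nonneg.2 (hχI x).2) hvneg.le
      linarith
  have huanti : AntitoneOn u (Ici 0) := by
    refine (strictAntiOn_of_deriv_neg (convex_Ici 0) hu.continuous.continuousOn
      fun x hx ↦ ?_).antitoneOn
    rw [interior_Ici] at hx
    exact hud x hx
  have huvIoi {x : ℝ} (hx : δ ≤ x) : EqOn u v (Ioi x) := fun y hy ↦ huv (hx.trans (le_of_lt hy))
  have huIoi {x : ℝ} (hx : δ ≤ x) : IntegrableOn u (Ioi x) :=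
    (hvi x).1.congr_fun (huvIoi hx).symm measurableSet_Ioi
  refine ⟨u, hu.contDiffOn, hu0, ?_, fun x hx ↦ ?_, fun j ↦ ?_, fun x hx ↦ ⟨?_, huε x hx⟩⟩
  · rw [← Icc_union_Ioi_eq_Ici hδ.le]
    exact (hu.continuous.integrableOn_Icc).union (huIoi le_rfl)
  · rw [derivWithin_of_mem_nhds (Ici_mem_nhds hx)]
    exact hud x hx
  · have hloc : u =ᶠ[nhds 0] f := by
      filter_upwards [hχ1] with x hx
      simp [u, hx]
    rw [iteratedDerivWithin_eq_iteratedDeriv (uniqueDiffOn_Ici 0)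
      (hu.contDiffAt.of_le (mod_cast le_top)) self_mem_Ici, hloc.iteratedDeriv_eq, hfβ]
  · rcases le_total δ x with h | h
    · rw [setIntegral_congr_fun measurableSet_Ioi (huvIoi h), huv h]
      linarith [(hvi x).2, hv0 x]
    · have hIoc : ∫ t in Ioc x δ, u t ≤ ∫ _ in Ioc x δ, u x :=
        setIntegral_mono_on (hu.continuous.integrableOn_Ioc) (by simp) measurableSet_Ioc
          fun t ht ↦ huanti hx (le_trans hx ht.1.le) ht.1.le
      rw [setIntegral_const, measureReal_def, Real.volume_Ioc,
        ENNReal.toReal_ofReal (sub_nonneg.2 h), smul_eq_mul] at hIoc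
      have hvx : v δ ≤ u x := huv le_rfl ▸ huanti hx hδ.le h
      rw [← Ioc_union_Ioi_eq_Ioi h, setIntegral_union (Ioc_disjoint_Ioi le_rfl) measurableSet_Ioi
        hu.continuous.integrableOn_Ioc (huIoi le_rfl),
        setIntegral_congr_fun measurableSet_Ioi (huvIoi le_rfl)]
      have hx' : 0 ≤ x := hx
      nlinarith [(hvi δ).2, hu0 x hx, hδS.2.2.2]
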